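/- arXiv:2604.22510 — 2 statements merged into one kernel-verified Lean document; each statement's English description precedes it below -/
import Mathlib

section
/- Let α > 0 and let ℓ: ℝⁿ × ℝ^m → ℝ be measurable and bounded below with infimum ℓ̲, satisfying ℓ(x,y) − ℓ̲ ≤ c_u(1 + |x|² + |y|²) for all x, y and some c_u > 0. Fix μ ∈ 𝒫₂(ℝⁿ), y₀ ∈ ℝ^m, and let η^{y₀} be the reweighted probability measure η^{y₀}(dx) = e^{−α ℓ(x,y₀)} μ(dx) / ∫ e^{−α ℓ(x,y₀)} μ(dx). Then for all real numbers K ≥ l > c_u(1 + M₂(μ) + |y₀|²), η^{y₀}({x ∈ ℝⁿ : ℓ(x,y₀) − ℓ̲ ≥ K}) ≤ e^{−α(K − l)} · [c_u(1 + M₂(μ) + |y₀|²)/K] / [1 − c_u(1 + M₂(μ) + |y₀|²)/l]. -/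
open MeasureTheory

noncomputable section

/-- `ℝ^m` with the Euclidean norm. -/
abbrev Euc (m : ℕ) : Type := EuclideanSpace ℝ (Fin m)

/-- The reweighted probability measure
`η^{y₀}(dx) = e^{-α ℓ(x,y₀)} μ(dx) / ∫ e^{-α ℓ(x,y₀)} μ(dx)`. -/
noncomputable def reweight {n m : ℕ} (α : ℝ) (ell : Euc n → Euc m → ℝ) (y0 : Euc m)
    (μ : Measure (Euc n)) : Measure (Euc n) :=
  (ENNReal.ofReal (∫ x, Real.exp (-α * ell x y0) ∂μ))⁻¹ •
    μ.withDensity (fun x => ENNReal.ofReal (Real.exp (-α * ell x y0)))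

/-- Markov's inequality, for a real-valued nonnegative function whose integral is at most `A`. -/
theorem measureReal_ge_le_div {Ω : Type*} [MeasurableSpace Ω] {μ : Measure Ω} {f : Ω → ℝ}
    (hf : 0 ≤ f) (hint : Integrable f μ) {A t : ℝ} (hA : ∫ x, f x ∂μ ≤ A) (ht : 0 < t) :
    μ.real {x | t ≤ f x} ≤ A / t := by
  rw [le_div_iff₀' ht]
  exact (mul_meas_ge_le_integral_of_nonneg (ae_of_all _ hf) hint t).trans hA

/-- A lower bound for the Laplace transform of a nonnegative function of mean at most `A`. -/
theorem exp_mul_one_sub_div_le_integral_exp {Ω : Type*} [MeasurableSpace Ω] {μ : Measure Ω}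
    [IsProbabilityMeasure μ] {f : Ω → ℝ} (hfm : Measurable f) (hf : 0 ≤ f) (hint : Integrable f μ)
    {A l α : ℝ} (hα : 0 ≤ α) (hA : ∫ x, f x ∂μ ≤ A) (hl : 0 < l)
    (hexp : Integrable (fun x => Real.exp (-α * f x)) μ) :
    Real.exp (-α * l) * (1 - A / l) ≤ ∫ x, Real.exp (-α * f x) ∂μ := by
  have hset : MeasurableSet {x | l ≤ f x} := measurableSet_le measurable_const hfm
  have hcompl : 1 - A / l ≤ μ.real {x | l ≤ f x}ᶜ := by
    rw [probReal_compl_eq_one_sub hset]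
    linarith [measureReal_ge_le_div hf hint hA hl]
  calc Real.exp (-α * l) * (1 - A / l)
      ≤ Real.exp (-α * l) * μ.real {x | l ≤ f x}ᶜ := by gcongr
    _ ≤ ∫ x in {x | l ≤ f x}ᶜ, Real.exp (-α * f x) ∂μ := by
        refine setIntegral_ge_of_const_le_real hset.compl (measure_ne_top _ _) (fun x hx => ?_)
          hexp.integrableOn
        have hx' : f x < l := not_le.mp hx
        exact Real.exp_le_exp.mpr (by nlinarith)
    _ ≤ ∫ x, Real.exp (-α * f x) ∂μ :=
        setIntegral_le_integral hexp (ae_of_all _ fun x => (Real.exp_pos _).le)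

/-- tail estimate for the reweighted measure `η^{y₀}`:
for all `K ≥ l > c_u (1 + M₂(μ) + |y₀|²)`,
`η^{y₀}({ℓ(·,y₀) - inf ℓ ≥ K}) ≤ e^{-α(K-l)} (A/K)/(1 - A/l)` with
`A = c_u (1 + M₂(μ) + |y₀|²)`. -/
theorem reweight_tail_bound {n m : ℕ} (α cu : ℝ) (hα : 0 < α) (hcu : 0 < cu)
    (ell : Euc n → Euc m → ℝ)
    (hmeas : Measurable (Function.uncurry ell))
    (hbdd : BddBelow (Set.range (Function.uncurry ell)))
    (hup : ∀ (x : Euc n) (y : Euc m),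
      ell x y - (⨅ p : Euc n × Euc m, ell p.1 p.2) ≤ cu * (1 + ‖x‖ ^ 2 + ‖y‖ ^ 2))
    (μ : Measure (Euc n)) [IsProbabilityMeasure μ]
    (hμ2 : Integrable (fun x => ‖x‖ ^ 2) μ)
    (y0 : Euc m) (K l : ℝ) (hlK : l ≤ K)
    (hl : cu * (1 + (∫ x, ‖x‖ ^ 2 ∂μ) + ‖y0‖ ^ 2) < l) :
    reweight α ell y0 μ
        {x | K ≤ ell x y0 - (⨅ p : Euc n × Euc m, ell p.1 p.2)} ≤
      ENNReal.ofReal (Real.exp (-α * (K - l)) *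
        (cu * (1 + (∫ x, ‖x‖ ^ 2 ∂μ) + ‖y0‖ ^ 2) / K) /
        (1 - cu * (1 + (∫ x, ‖x‖ ^ 2 ∂μ) + ‖y0‖ ^ 2) / l)) := by
  set b : ℝ := ⨅ p : Euc n × Euc m, ell p.1 p.2 with hb
  set A : ℝ := cu * (1 + (∫ x, ‖x‖ ^ 2 ∂μ) + ‖y0‖ ^ 2) with hAdef
  have hA : 0 < A := by
    have : 0 ≤ ∫ x, ‖x‖ ^ 2 ∂μ := integral_nonneg fun x => by positivity
    positivity
  have hl0 : 0 < l := hA.trans hl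
  have hK0 : 0 < K := hl0.trans_le hlK
  have hden : 0 < 1 - A / l := by
    rw [sub_pos, div_lt_one hl0]
    exact hl
  have hellm : Measurable fun x => ell x y0 := hmeas.comp (measurable_id.prodMk measurable_const)
  set f : Euc n → ℝ := fun x => ell x y0 - b with hf
  have hfm : Measurable f := hellm.sub_const b
  have hf0 : 0 ≤ f := fun x => sub_nonneg.mpr (ciInf_le hbdd (x, y0))
  have hint1 : Integrable (fun x : Euc n => 1 + ‖x‖ ^ 2) μ := (integrable_const 1).add hμ2
  have hgint : Integrable (fun x : Euc n => cu * (1 + ‖x‖ ^ 2 + ‖y0‖ ^ 2)) μ :=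
    (hint1.add (integrable_const _)).const_mul cu
  have hfint : Integrable f μ := by
    refine hgint.mono' hfm.aestronglyMeasurable (ae_of_all _ fun x => ?_)
    rw [Real.norm_of_nonneg (hf0 x)]
    exact hup x y0
  have hfA : ∫ x, f x ∂μ ≤ A := by
    refine (integral_mono hfint hgint fun x => hup x y0).trans_eq ?_
    rw [integral_const_mul, integral_add hint1 (integrable_const _),
      integral_add (integrable_const 1) hμ2]
    simp [hAdef]
  have hexp : Integrable (fun x => Real.exp (-α * f x)) μ := by
    refine (integrable_const (1 : ℝ)).mono' (hfm.const_mul _).exp.aestronglyMeasurable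
      (ae_of_all _ fun x => ?_)
    rw [Real.norm_of_nonneg (Real.exp_pos _).le, Real.exp_le_one_iff]
    have : 0 ≤ f x := hf0 x
    nlinarith
  have hfactor : ∀ x, Real.exp (-α * ell x y0) = Real.exp (-α * b) * Real.exp (-α * f x) := by
    intro x
    rw [← Real.exp_add]
    congr 1
    simp only [hf]
    ring
  have hZ : Real.exp (-α * b) * (Real.exp (-α * l) * (1 - A / l)) ≤
      ∫ x, Real.exp (-α * ell x y0) ∂μ := by
    simp_rw [hfactor]
    rw [integral_const_mul]
    gcongr
    exact exp_mul_one_sub_div_le_integral_exp hfm hf0 hfint hα.le hfA hl0 hexp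
  have hZ0 : 0 < ∫ x, Real.exp (-α * ell x y0) ∂μ := lt_of_lt_of_le (by positivity) hZ
  have hset : MeasurableSet {x | K ≤ f x} := measurableSet_le measurable_const hfm
  have hnum : μ.withDensity (fun x => ENNReal.ofReal (Real.exp (-α * ell x y0))) {x | K ≤ f x} ≤
      ENNReal.ofReal (Real.exp (-α * b) * Real.exp (-α * K) * (A / K)) := by
    rw [withDensity_apply _ hset]
    calc ∫⁻ x in {x | K ≤ f x}, ENNReal.ofReal (Real.exp (-α * ell x y0)) ∂μ
        ≤ ∫⁻ _ in {x | K ≤ f x}, ENNReal.ofReal (Real.exp (-α * b) * Real.exp (-α * K)) ∂μ := by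
          refine setLIntegral_mono measurable_const fun x hx => ENNReal.ofReal_le_ofReal ?_
          have hx' : K ≤ f x := hx
          rw [hfactor]
          gcongr Real.exp (-α * b) * Real.exp ?_
          nlinarith
      _ = ENNReal.ofReal (Real.exp (-α * b) * Real.exp (-α * K) * μ.real {x | K ≤ f x}) := by
          rw [setLIntegral_const, ENNReal.ofReal_mul (q := μ.real _) (by positivity),
            ofReal_measureReal]
      _ ≤ _ := by
          gcongr
          exact measureReal_ge_le_div hf0 hfint hfA hK0
  have hsplit : Real.exp (-α * K) = Real.exp (-α * (K - l)) * Real.exp (-α * l) := by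
    rw [← Real.exp_add]
    congr 1
    ring
  rw [reweight, Measure.smul_apply, smul_eq_mul, ← ENNReal.ofReal_inv_of_pos hZ0]
  refine (mul_le_mul_right hnum _).trans ?_
  rw [← ENNReal.ofReal_mul (by positivity)]
  refine ENNReal.ofReal_le_ofReal ?_
  rw [inv_mul_le_iff₀ hZ0]
  calc Real.exp (-α * b) * Real.exp (-α * K) * (A / K)
      = Real.exp (-α * b) * (Real.exp (-α * l) * (1 - A / l)) *
          (Real.exp (-α * (K - l)) * (A / K) / (1 - A / l)) := by
        rw [hsplit, mul_div_assoc']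
        generalize 1 - A / l = d at hden
        field_simp
    _ ≤ _ := by gcongr
end
end

section
/- Let α > 0 and let ℓ: ℝⁿ × ℝ^m → ℝ be measurable and bounded below with infimum ℓ̲, satisfying ℓ(x,y) − ℓ̲ ≤ c_u(1 + |x|² + |y|²) for all x, y, and suppose there exist M > 0 and c_l > 0 such that for every y₀ ∈ ℝ^m, ℓ(x,y₀) − ℓ̲ ≥ c_l|x|² whenever |x| > M + |y₀|. Assume α c_l ≥ 2. Then for every μ ∈ 𝒫₂(ℝⁿ) and y₀ ∈ ℝ^m, the reweighted probability measure η^{y₀}(dx) = e^{−α ℓ(x,y₀)} μ(dx) / ∫ e^{−α ℓ(x,y₀)} μ(dx) satisfies ∫ |x|² η^{y₀}(dx) ≤ (M + |y₀|)² + 2(c_u/c_l)(1 + |y₀|² + M₂(μ)) + (2c_u/c_l)(1 + |y₀|² + M₂(μ))/(M + |y₀|)². -/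
open MeasureTheory
open scoped ENNReal

noncomputable section

/-- Reweighting by `e^{-α g}` with `α ≥ 0` does not increase the mean of `g`. -/
theorem integral_mul_exp_neg_le {Ω : Type*} [MeasurableSpace Ω] {μ : Measure Ω}
    [IsProbabilityMeasure μ] {α : ℝ} (hα : 0 ≤ α) {g : Ω → ℝ} (hg : Integrable g μ)
    (hw : Integrable (fun x => Real.exp (-α * g x)) μ)
    (hgw : Integrable (fun x => g x * Real.exp (-α * g x)) μ) :
    ∫ x, g x * Real.exp (-α * g x) ∂μ ≤ (∫ x, g x ∂μ) * ∫ x, Real.exp (-α * g x) ∂μ := by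
  set a := ∫ x, g x ∂μ with ha
  have key : ∀ x, g x * Real.exp (-α * g x) - a * Real.exp (-α * g x) ≤
      (g x - a) * Real.exp (-α * a) := by
    intro x
    rcases le_total a (g x) with h | h
    · have : Real.exp (-α * g x) ≤ Real.exp (-α * a) := Real.exp_le_exp.2 (by nlinarith)
      nlinarith
    · have : Real.exp (-α * a) ≤ Real.exp (-α * g x) := Real.exp_le_exp.2 (by nlinarith)
      nlinarith
  have h := integral_mono (hgw.sub (hw.const_mul a))
    ((hg.sub (integrable_const a)).mul_const (Real.exp (-α * a))) key
  have h1 : ∫ x, (g x - a) * Real.exp (-α * a) ∂μ = 0 := by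
    rw [integral_mul_const, integral_sub hg (integrable_const a)]
    simp [ha]
  have h2 : ∫ x, (g x * Real.exp (-α * g x) - a * Real.exp (-α * g x)) ∂μ =
      ∫ x, g x * Real.exp (-α * g x) ∂μ - a * ∫ x, Real.exp (-α * g x) ∂μ := by
    rw [integral_sub hgw (hw.const_mul a), integral_const_mul]
  have h' : ∫ x, (g x * Real.exp (-α * g x) - a * Real.exp (-α * g x)) ∂μ ≤
      ∫ x, (g x - a) * Real.exp (-α * a) ∂μ := h
  linarith

/-- second moment bound for the reweighted measure `η^{y₀}`. -/
theorem reweight_second_moment_bound {n m : ℕ} (α cu cl M : ℝ) (hα : 0 < α)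
    (hcu : 0 < cu) (hcl : 0 < cl) (hM : 0 < M) (hαcl : 2 ≤ α * cl)
    (ell : Euc n → Euc m → ℝ)
    (hmeas : Measurable (Function.uncurry ell))
    (hbdd : BddBelow (Set.range (Function.uncurry ell)))
    (hup : ∀ (x : Euc n) (y : Euc m),
      ell x y - (⨅ p : Euc n × Euc m, ell p.1 p.2) ≤ cu * (1 + ‖x‖ ^ 2 + ‖y‖ ^ 2))
    (hlow : ∀ (y0 : Euc m) (x : Euc n), M + ‖y0‖ < ‖x‖ →
      cl * ‖x‖ ^ 2 ≤ ell x y0 - (⨅ p : Euc n × Euc m, ell p.1 p.2))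
    (μ : Measure (Euc n)) [IsProbabilityMeasure μ]
    (hμ2 : Integrable (fun x => ‖x‖ ^ 2) μ) (y0 : Euc m) :
    (∫⁻ x, (‖x‖₊ : ℝ≥0∞) ^ 2 ∂(reweight α ell y0 μ)) ≤
      ENNReal.ofReal ((M + ‖y0‖) ^ 2 +
        2 * (cu / cl) * (1 + ‖y0‖ ^ 2 + ∫ x, ‖x‖ ^ 2 ∂μ) +
        (2 * cu / cl) * (1 + ‖y0‖ ^ 2 + ∫ x, ‖x‖ ^ 2 ∂μ) / (M + ‖y0‖) ^ 2) := by
  set L : ℝ := ⨅ p : Euc n × Euc m, ell p.1 p.2 with hL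
  set g : Euc n → ℝ := fun x => ell x y0 with hg
  set w : Euc n → ℝ := fun x => Real.exp (-α * ell x y0) with hw
  set R : ℝ := M + ‖y0‖ with hR
  set S : ℝ := ∫ x, ‖x‖ ^ 2 ∂μ with hS
  have hRpos : 0 < R := by positivity
  have hS0 : 0 ≤ S := integral_nonneg fun x => by positivity
  have hLg : ∀ x, L ≤ g x := fun x => ciInf_le hbdd (x, y0)
  have hgm : Measurable g := hmeas.comp (measurable_id.prodMk measurable_const)
  have hwm : Measurable w := Real.measurable_exp.comp (hgm.const_mul (-α))
  have hwpos : ∀ x, 0 < w x := fun x => Real.exp_pos _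
  have hwle : ∀ x, ‖w x‖ ≤ Real.exp (-α * L) := by
    intro x
    rw [Real.norm_of_nonneg (hwpos x).le]
    exact Real.exp_le_exp.2 (by nlinarith [hLg x])
  have h1i : Integrable (fun x : Euc n => 1 + ‖x‖ ^ 2) μ := (integrable_const 1).add hμ2
  have hupi : Integrable (fun x => cu * (1 + ‖x‖ ^ 2 + ‖y0‖ ^ 2)) μ :=
    (h1i.add (integrable_const _)).const_mul cu
  have hfi : Integrable (fun x => g x - L) μ := by
    refine hupi.mono' (hgm.sub_const L).aestronglyMeasurable (ae_of_all _ fun x => ?_)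
    rw [Real.norm_of_nonneg (sub_nonneg.2 (hLg x))]
    exact hup x y0
  have hgi : Integrable g μ := by
    refine (hfi.add (integrable_const L)).congr (ae_of_all _ fun x => ?_)
    simp
  have hwi : Integrable w μ :=
    (integrable_const (Real.exp (-α * L))).mono' hwm.aestronglyMeasurable (ae_of_all _ hwle)
  have hgwi : Integrable (fun x => g x * w x) μ :=
    hgi.mul_bdd hwm.aestronglyMeasurable (ae_of_all _ hwle)
  have hxwi : Integrable (fun x => ‖x‖ ^ 2 * w x) μ :=
    hμ2.mul_bdd hwm.aestronglyMeasurable (ae_of_all _ hwle)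
  have hZ : 0 < ∫ x, w x ∂μ := integral_exp_pos hwi
  have hmean : ∫ x, g x ∂μ - L ≤ cu * (1 + ‖y0‖ ^ 2 + S) := by
    have h := integral_mono hfi hupi (fun x => hup x y0)
    rw [integral_sub hgi (integrable_const L), integral_const_mul,
      integral_add h1i (integrable_const _),
      integral_add (integrable_const 1) hμ2] at h
    simp only [integral_const, probReal_univ, one_smul] at h
    linarith
  have hcov : ∫ x, g x * w x ∂μ ≤ (∫ x, g x ∂μ) * ∫ x, w x ∂μ :=
    integral_mul_exp_neg_le hα.le hgi hwi hgwi
  have hpt : ∀ x, ‖x‖ ^ 2 * w x ≤ (R ^ 2 - L / cl) * w x + cl⁻¹ * (g x * w x) := by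
    intro x
    have hx : ‖x‖ ^ 2 ≤ R ^ 2 + (g x - L) / cl := by
      have hf : 0 ≤ (g x - L) / cl := div_nonneg (sub_nonneg.2 (hLg x)) hcl.le
      rcases le_or_gt ‖x‖ R with h | h
      · nlinarith [norm_nonneg x]
      · have := (le_div_iff₀' hcl).2 (hlow y0 x h)
        nlinarith
    calc ‖x‖ ^ 2 * w x ≤ (R ^ 2 + (g x - L) / cl) * w x :=
          mul_le_mul_of_nonneg_right hx (hwpos x).le
      _ = _ := by ring
  have hmain : ∫ x, ‖x‖ ^ 2 * w x ∂μ ≤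
      (R ^ 2 + cu / cl * (1 + ‖y0‖ ^ 2 + S)) * ∫ x, w x ∂μ := by
    have h := integral_mono hxwi ((hwi.const_mul (R ^ 2 - L / cl)).add (hgwi.const_mul cl⁻¹)) hpt
    simp only [Pi.add_apply] at h
    rw [integral_add (hwi.const_mul _) (hgwi.const_mul _), integral_const_mul,
      integral_const_mul] at h
    calc _ ≤ _ := h
      _ ≤ (R ^ 2 - L / cl) * ∫ x, w x ∂μ + cl⁻¹ * ((∫ x, g x ∂μ) * ∫ x, w x ∂μ) := by gcongr
      _ = (R ^ 2 + cl⁻¹ * (∫ x, g x ∂μ - L)) * ∫ x, w x ∂μ := by ring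
      _ ≤ (R ^ 2 + cl⁻¹ * (cu * (1 + ‖y0‖ ^ 2 + S))) * ∫ x, w x ∂μ := by gcongr
      _ = _ := by ring
  have hint : ∫⁻ x, (‖x‖₊ : ℝ≥0∞) ^ 2 ∂(reweight α ell y0 μ) =
      ENNReal.ofReal ((∫ x, ‖x‖ ^ 2 * w x ∂μ) / ∫ x, w x ∂μ) := by
    rw [reweight, lintegral_smul_measure, lintegral_withDensity_eq_lintegral_mul _
      hwm.ennreal_ofReal (by fun_prop), ENNReal.ofReal_div_of_pos hZ,
      ofReal_integral_eq_lintegral_ofReal hxwi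
        (ae_of_all _ fun x => mul_nonneg (by positivity) (hwpos x).le),
      smul_eq_mul, mul_comm, ENNReal.div_eq_inv_mul, mul_comm]
    congr 1
    refine lintegral_congr fun x => ?_
    rw [Pi.mul_apply, ENNReal.ofReal_mul (by positivity), ENNReal.ofReal_pow (norm_nonneg x),
      ofReal_norm, mul_comm]
    rfl
  rw [hint]
  refine ENNReal.ofReal_le_ofReal (((div_le_iff₀ hZ).2 hmain).trans ?_)
  have h1 : 0 ≤ cu / cl * (1 + ‖y0‖ ^ 2 + S) := by positivity
  have h2 : 0 ≤ 2 * cu / cl * (1 + ‖y0‖ ^ 2 + S) / R ^ 2 := by positivity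
  linarith
end
end
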